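/- Let φ(x) = 1 + x^2 and let f : [0,∞) → ℝ be continuous with |f(x)| ≤ M_f · φ(x) for some constant M_f > 0 and such that the limit lim_{x→∞} f(x)/φ(x) exists. Then the weighted norms converge: lim_{n→∞} sup_{x ≥ 0} | M_n^{(α,β)}[f](x) − f(x) | / (1 + x^2) = 0, where the limit is over natural numbers n > β. -/

import Mathlib

open MeasureTheory Real Filter

/-- The Szász–Mirakyan basis functions `ψ_{n,k}(x) = e^{-nx} (nx)^k / k!`. -/
noncomputable def psi (n k : ℕ) (x : ℝ) : ℝ :=
  Real.exp (-(n * x)) * (n * x) ^ k / (Nat.factorial k)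

/-- The Szász–Mirakyan–Laguerre–Durrmeyer operator `M_n^{(α,β)}`. -/
noncomputable def M (α β : ℝ) (n : ℕ) (f : ℝ → ℝ) (x : ℝ) : ℝ :=
  ∑' k : ℕ, (((n : ℝ) - β) ^ ((k : ℝ) + α + 1) / Real.Gamma ((k : ℝ) + α + 1)) *
    (∫ t in Set.Ioi (0 : ℝ), f t * t ^ ((k : ℝ) + α) * Real.exp (-((n : ℝ) - β) * t)) *
    psi n k x

/-- The `r`-th moment `μ_r^{(α,β)}(x) = M_n^{(α,β)}[t ↦ t^r](x)`. -/
noncomputable def mu (α β : ℝ) (n : ℕ) (r : ℕ) (x : ℝ) : ℝ :=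
  M α β n (fun t => t ^ r) x

lemma hasInt_rpow (s a : ℝ) (hs : -1 < s) (ha : 0 < a) :
    IntegrableOn (fun t : ℝ => t ^ s * Real.exp (-a * t)) (Set.Ioi 0) := by
  have := integrableOn_rpow_mul_exp_neg_mul_rpow hs one_pos ha
  simpa using this

lemma int_rpow (s a : ℝ) (hs : -1 < s) (ha : 0 < a) :
    ∫ t in Set.Ioi (0:ℝ), t ^ s * Real.exp (-a * t) = Real.Gamma (s + 1) / a ^ (s + 1) := by
  have := Real.integral_rpow_mul_exp_neg_mul_Ioi (a := s + 1) (r := a) (by linarith) ha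
  rw [add_sub_cancel_right] at this
  simp only [neg_mul]
  rw [this, Real.div_rpow zero_le_one ha.le, Real.one_rpow]
  ring

/-- Integrability and value of the quadratic test functions. -/
lemma quad_int (s a p q r : ℝ) (hs : -1 < s) (ha : 0 < a) :
    IntegrableOn (fun t : ℝ => (p + q * t + r * t ^ 2) * t ^ s * Real.exp (-a * t)) (Set.Ioi 0) ∧
    a ^ (s + 1) / Real.Gamma (s + 1) *
      ∫ t in Set.Ioi (0:ℝ), (p + q * t + r * t ^ 2) * t ^ s * Real.exp (-a * t)
      = p + q * ((s + 1) / a) + r * ((s + 1) * (s + 2) / a ^ 2) := by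
  have h0 := hasInt_rpow s a hs ha
  have h1 := hasInt_rpow (s + 1) a (by linarith) ha
  have h2 := hasInt_rpow (s + 1 + 1) a (by linarith) ha
  have hcomb := ((h0.const_mul p).add (h1.const_mul q)).add (h2.const_mul r)
  have heq : Set.EqOn (fun t : ℝ => p * (t ^ s * Real.exp (-a * t))
      + q * (t ^ (s + 1) * Real.exp (-a * t)) + r * (t ^ (s + 1 + 1) * Real.exp (-a * t)))
      (fun t : ℝ => (p + q * t + r * t ^ 2) * t ^ s * Real.exp (-a * t)) (Set.Ioi 0) := by
    intro t ht
    have ht : 0 < t := ht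
    simp only [Real.rpow_add_one ht.ne']
    ring
  have hcI : IntegrableOn (fun t : ℝ => p * (t ^ s * Real.exp (-a * t))
      + q * (t ^ (s + 1) * Real.exp (-a * t)) + r * (t ^ (s + 1 + 1) * Real.exp (-a * t)))
      (Set.Ioi 0) := hcomb
  refine ⟨hcI.congr_fun heq measurableSet_Ioi, ?_⟩
  rw [← setIntegral_congr_fun measurableSet_Ioi heq]
  have h01 : IntegrableOn (fun t : ℝ => p * (t ^ s * Real.exp (-a * t))
      + q * (t ^ (s + 1) * Real.exp (-a * t))) (Set.Ioi 0) :=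
    (h0.const_mul p).add (h1.const_mul q)
  rw [integral_add h01 (h2.const_mul r),
    integral_add (h0.const_mul p) (h1.const_mul q), integral_const_mul, integral_const_mul,
    integral_const_mul, int_rpow s a hs ha, int_rpow (s+1) a (by linarith) ha,
    int_rpow (s+1+1) a (by linarith) ha,
    Real.Gamma_add_one (s := s + 1 + 1) (by linarith), Real.Gamma_add_one (s := s + 1) (by linarith),
    Real.rpow_add_one ha.ne' (s + 1 + 1), Real.rpow_add_one ha.ne' (s + 1)]
  have hG : 0 < Real.Gamma (s + 1) := Real.Gamma_pos_of_pos (by linarith)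
  have hA : 0 < a ^ (s + 1) := Real.rpow_pos_of_pos ha _
  field_simp
  ring

/-- Local estimate for one term. -/
lemma term_est (s a : ℝ) (hs : -1 < s) (ha : 0 < a) (f : ℝ → ℝ)
    (hf : ContinuousOn f (Set.Ici 0)) (x y e C : ℝ)
    (h : ∀ t : ℝ, 0 ≤ t → |f t - y| ≤ e + C * (t - x) ^ 2) :
    |a ^ (s + 1) / Real.Gamma (s + 1) *
      (∫ t in Set.Ioi (0:ℝ), f t * t ^ s * Real.exp (-a * t)) - y| ≤
      e + C * ((s + 1) * (s + 2) / a ^ 2 - 2 * x * ((s + 1) / a) + x ^ 2) := by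
  have hG : 0 < Real.Gamma (s + 1) := Real.Gamma_pos_of_pos (by linarith)
  have hA : 0 < a ^ (s + 1) := Real.rpow_pos_of_pos ha _
  have hc : 0 < a ^ (s + 1) / Real.Gamma (s + 1) := by positivity
  obtain ⟨i1, v1⟩ := quad_int s a y 0 0 hs ha
  obtain ⟨i2, v2⟩ := quad_int s a (e + C * x ^ 2) (- 2 * C * x) C hs ha
  have hmeas : AEStronglyMeasurable (fun t => (f t - y) * t ^ s * Real.exp (-a * t))
      (volume.restrict (Set.Ioi 0)) := by
    refine ContinuousOn.aestronglyMeasurable ?_ measurableSet_Ioi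
    have hf' : ContinuousOn f (Set.Ioi 0) := hf.mono Set.Ioi_subset_Ici_self
    have hp : ContinuousOn (fun t : ℝ => t ^ s) (Set.Ioi 0) :=
      fun t ht => (Real.continuousAt_rpow_const t s (Or.inl (ne_of_gt ht))).continuousWithinAt
    have he : Continuous (fun t : ℝ => Real.exp (-a * t)) := by fun_prop
    exact ((hf'.sub continuousOn_const).mul hp).mul he.continuousOn
  have hle : ∀ t ∈ Set.Ioi (0:ℝ), ‖(f t - y) * t ^ s * Real.exp (-a * t)‖ ≤
      (e + C * x ^ 2 + - 2 * C * x * t + C * t ^ 2) * t ^ s * Real.exp (-a * t) := by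
    intro t ht
    have ht : 0 < t := ht
    have hp : 0 < t ^ s := Real.rpow_pos_of_pos ht _
    rw [norm_mul, norm_mul, Real.norm_of_nonneg hp.le, Real.norm_of_nonneg (Real.exp_pos _).le,
      Real.norm_eq_abs]
    have := h t ht.le
    gcongr
    linarith
  have hae := (ae_restrict_iff' (μ := volume) (measurableSet_Ioi (a := (0:ℝ)))).2
    (Filter.Eventually.of_forall hle)
  have i3 : IntegrableOn (fun t => (f t - y) * t ^ s * Real.exp (-a * t)) (Set.Ioi 0) :=
    Integrable.mono' i2 hmeas hae
  have hsplit : ∫ t in Set.Ioi (0:ℝ), f t * t ^ s * Real.exp (-a * t) =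
      (∫ t in Set.Ioi (0:ℝ), (f t - y) * t ^ s * Real.exp (-a * t)) +
      ∫ t in Set.Ioi (0:ℝ), (y + 0 * t + 0 * t ^ 2) * t ^ s * Real.exp (-a * t) := by
    rw [← integral_add i3 i1]
    congr 1
    ext t
    ring
  have hn := norm_integral_le_of_norm_le i2 hae
  rw [hsplit, mul_add, v1]
  rw [show ∀ z : ℝ, z + (y + 0 * ((s + 1) / a) + 0 * ((s + 1) * (s + 2) / a ^ 2)) - y = z by
    intro z; ring, abs_mul, abs_of_pos hc]
  rw [Real.norm_eq_abs] at hn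
  calc _ ≤ _ := mul_le_mul_of_nonneg_left hn hc.le
    _ = _ := by rw [v2]; ring

lemma hasSum_of_eq {u v : ℕ → ℝ} {a b : ℝ} (h : HasSum u a) (huv : ∀ k, v k = u k)
    (hab : b = a) : HasSum v b := by
  rw [hab, funext huv]; exact h

lemma psi_nonneg (n k : ℕ) (x : ℝ) (hx : 0 ≤ x) : 0 ≤ psi n k x := by
  unfold psi; positivity

lemma psi_sum0 (n : ℕ) (x : ℝ) : HasSum (fun k => psi n k x) 1 := by
  have := (NormedSpace.expSeries_div_hasSum_exp ((n:ℝ) * x)).mul_left (Real.exp (-(n * x)))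
  rw [← Real.exp_eq_exp_ℝ, ← Real.exp_add, neg_add_cancel, Real.exp_zero] at this
  refine hasSum_of_eq this (fun k => ?_) rfl
  unfold psi; ring

lemma psi_succ (n k : ℕ) (x : ℝ) : ((k:ℝ) + 1) * psi n (k+1) x = n * x * psi n k x := by
  unfold psi
  rw [Nat.factorial_succ]
  push_cast
  have : ((k:ℝ) + 1) ≠ 0 := by positivity
  field_simp
  try ring

lemma psi_sum1 (n : ℕ) (x : ℝ) : HasSum (fun k : ℕ => (k:ℝ) * psi n k x) (n * x) := by
  rw [← hasSum_nat_add_iff' 1]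
  have := (psi_sum0 n x).mul_left (n * x : ℝ)
  simp only [Finset.range_one, Finset.sum_singleton, Nat.cast_zero, zero_mul, sub_zero]
  refine hasSum_of_eq this (fun k => ?_) ?_
  · push_cast; exact psi_succ n k x
  · simp

lemma psi_sum2 (n : ℕ) (x : ℝ) :
    HasSum (fun k : ℕ => (k:ℝ) * (k - 1) * psi n k x) ((n * x) ^ 2) := by
  rw [← hasSum_nat_add_iff' 1]
  have := (psi_sum1 n x).mul_left (n * x : ℝ)
  simp only [Finset.range_one, Finset.sum_singleton, Nat.cast_zero, zero_mul, sub_zero]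
  refine hasSum_of_eq this (fun k => ?_) ?_
  · push_cast
    linear_combination (k:ℝ) * psi_succ n k x
  · ring

/-- Global estimate for the operator. -/
lemma M_est (α β : ℝ) (hα : -1 < α) (n : ℕ) (hn : β < n) (f : ℝ → ℝ)
    (hf : ContinuousOn f (Set.Ici 0)) (x y e C : ℝ) (hx : 0 ≤ x)
    (h : ∀ t : ℝ, 0 ≤ t → |f t - y| ≤ e + C * (t - x) ^ 2) :
    |M α β n f x - y| ≤ e + C * (((n * x) ^ 2 + 2 * (α + 2) * (n * x) + (α + 1) * (α + 2))
      / (n - β) ^ 2 - 2 * x * ((n * x + α + 1) / (n - β)) + x ^ 2) := by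
  have ha : 0 < (n:ℝ) - β := by linarith
  set a := (n:ℝ) - β with hadef
  set T : ℕ → ℝ := fun k => (a ^ ((k : ℝ) + α + 1) / Real.Gamma ((k : ℝ) + α + 1)) *
    (∫ t in Set.Ioi (0 : ℝ), f t * t ^ ((k : ℝ) + α) * Real.exp (-a * t)) with hT
  have hM : M α β n f x = ∑' k, T k * psi n k x := rfl
  set B : ℕ → ℝ := fun k => e + C * (((k:ℝ) + α + 1) * ((k:ℝ) + α + 2) / a ^ 2
    - 2 * x * (((k:ℝ) + α + 1) / a) + x ^ 2) with hB
  have hk : ∀ k, |T k - y| ≤ B k := by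
    intro k
    have hk0 : (0:ℝ) ≤ k := Nat.cast_nonneg k
    exact term_est ((k:ℝ) + α) a (by linarith) ha f hf x y e C h
  have hS : HasSum (fun k => B k * psi n k x)
      (e + C * (((n * x) ^ 2 + 2 * (α + 2) * (n * x) + (α + 1) * (α + 2))
      / a ^ 2 - 2 * x * ((n * x + α + 1) / a) + x ^ 2)) := by
    have := (((psi_sum2 n x).mul_left (C / a ^ 2)).add
      ((psi_sum1 n x).mul_left (C * (2 * (α + 2)) / a ^ 2 - 2 * C * x / a))).add
      ((psi_sum0 n x).mul_left (e + C * ((α + 1) * (α + 2)/ a ^ 2 - 2 * x * ((α + 1) / a) + x ^ 2)))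
    refine hasSum_of_eq this (fun k => ?_) ?_
    · simp only [hB]
      field_simp
      ring
    · field_simp
      ring
  have hle : ∀ k, ‖(T k - y) * psi n k x‖ ≤ B k * psi n k x := by
    intro k
    rw [norm_mul, Real.norm_of_nonneg (psi_nonneg n k x hx), Real.norm_eq_abs]
    exact mul_le_mul_of_nonneg_right (hk k) (psi_nonneg n k x hx)
  have hsum : Summable (fun k => (T k - y) * psi n k x) :=
    Summable.of_norm_bounded hS.summable hle
  have h2 := hsum.hasSum.add ((psi_sum0 n x).mul_left y)
  have h3 : M α β n f x = (∑' k, (T k - y) * psi n k x) + y * 1 := by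
    rw [hM, ← h2.tsum_eq]
    congr 1
    ext k
    ring
  have h4 := tsum_of_norm_bounded hS hle
  rw [h3, mul_one, add_sub_cancel_right]
  exact h4

lemma second_moment (A β a x : ℝ) (hA : 0 < A) (hβ : 0 ≤ β) (ha : 1 ≤ a) (hx : 0 ≤ x) :
    (((a + β) * x) ^ 2 + 2 * (A + 1) * ((a + β) * x) + A * (A + 1)) / a ^ 2
      - 2 * x * (((a + β) * x + A) / a) + x ^ 2 ≤
      (β ^ 2 + 2 * (A + 1) * (1 + β) + A * (A + 1)) / a * (1 + x ^ 2) := by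
  have ha0 : 0 < a := by linarith
  have e1 : (((a + β) * x) ^ 2 + 2 * (A + 1) * ((a + β) * x) + A * (A + 1)) / a ^ 2
      - 2 * x * (((a + β) * x + A) / a) + x ^ 2 =
      (β ^ 2 * x ^ 2 + 2 * (A + 1) * (a + β) * x - 2 * A * a * x + A * (A + 1)) / a ^ 2 := by
    field_simp
    ring
  have e2 : (β ^ 2 + 2 * (A + 1) * (1 + β) + A * (A + 1)) / a * (1 + x ^ 2) =
      (a * (β ^ 2 + 2 * (A + 1) * (1 + β) + A * (A + 1)) * (1 + x ^ 2)) / a ^ 2 := by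
    field_simp
  rw [e1, e2]
  apply div_le_div_of_nonneg_right _ (by positivity)
  have hx1 : x ≤ 1 + x ^ 2 := by nlinarith [sq_nonneg (x - 1)]
  have t1 : β ^ 2 * x ^ 2 ≤ a * β ^ 2 * (1 + x ^ 2) := by
    have : 1 * (β ^ 2 * x ^ 2) ≤ a * (β ^ 2 * (1 + x ^ 2)) := by
      gcongr; linarith
    linarith
  have t2 : 2 * (A + 1) * (a + β) * x ≤ 2 * (A + 1) * (a * (1 + β)) * (1 + x ^ 2) := by
    gcongr
    nlinarith
  have t3 : 0 ≤ 2 * A * a * x := by positivity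
  have t4 : A * (A + 1) ≤ a * (A * (A + 1)) * (1 + x ^ 2) := by
    have : 1 * (A * (A + 1)) * 1 ≤ a * (A * (A + 1)) * (1 + x ^ 2) := by
      gcongr; nlinarith [sq_nonneg x]
    linarith
  linarith

/-- The Korovkin-type pointwise estimate. -/
lemma ptwise (f : ℝ → ℝ) (hf : ContinuousOn f (Set.Ici 0))
    (Mf : ℝ) (hMf : 0 < Mf) (hbound : ∀ x : ℝ, 0 ≤ x → |f x| ≤ Mf * (1 + x ^ 2))
    (L : ℝ) (hL : Filter.Tendsto (fun x => f x / (1 + x ^ 2)) Filter.atTop (nhds L))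
    (ε : ℝ) (hε : 0 < ε) :
    ∃ C : ℝ, 0 ≤ C ∧ ∀ x t : ℝ, 0 ≤ x → 0 ≤ t →
      |f t - f x| ≤ ε * (1 + x ^ 2) + C * (t - x) ^ 2 := by
  set h : ℝ → ℝ := fun x => f x / (1 + x ^ 2) with hh
  have hφ : ∀ x : ℝ, 0 < 1 + x ^ 2 := fun x => by positivity
  have hfh : ∀ x, f x = h x * (1 + x ^ 2) := fun x => by
    simp only [hh]; rw [div_mul_cancel₀ _ (hφ x).ne']
  have hb : ∀ x, 0 ≤ x → |h x| ≤ Mf := fun x hx => by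
    simp only [hh]
    rw [abs_div, abs_of_pos (hφ x), div_le_iff₀ (hφ x)]
    exact hbound x hx
  have hc : ContinuousOn h (Set.Ici 0) :=
    hf.div (by fun_prop) (fun x _ => (hφ x).ne')
  have key : ∃ D : ℝ, 0 ≤ D ∧ ∀ x t : ℝ, 0 ≤ x → 0 ≤ t →
      |h t - h x| * (1 + x ^ 2) ≤ ε / 2 * (1 + x ^ 2) + D * (t - x) ^ 2 := by
    obtain ⟨X0, hX0⟩ := (Metric.tendsto_atTop.1 hL) (ε / 4) (by positivity)
    set X := max X0 1 with hX
    have hX1 : 1 ≤ X := le_max_right _ _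
    have huc := (isCompact_Icc (a := (0:ℝ)) (b := 2 * X + 1)).uniformContinuousOn_of_continuous
      (hc.mono Set.Icc_subset_Ici_self)
    obtain ⟨δ, hδ, hδ'⟩ := Metric.uniformContinuousOn_iff.1 huc (ε / 2) (by positivity)
    set d := min δ 1 with hd
    have hd0 : 0 < d := lt_min hδ one_pos
    have hd1 : d ≤ 1 := min_le_right _ _
    have hdδ : d ≤ δ := min_le_left _ _
    refine ⟨2 * Mf * ((1 + 4 * X ^ 2) / d ^ 2) + 2 * Mf * 8, by positivity, ?_⟩
    intro x t hx ht
    have hsmall : |h t - h x| ≤ ε / 2 → |h t - h x| * (1 + x ^ 2) ≤ ε / 2 * (1 + x ^ 2) +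
        (2 * Mf * ((1 + 4 * X ^ 2) / d ^ 2) + 2 * Mf * 8) * (t - x) ^ 2 := by
      intro H
      have h1 := mul_le_mul_of_nonneg_right H (hφ x).le
      have h2 : 0 ≤ (2 * Mf * ((1 + 4 * X ^ 2) / d ^ 2) + 2 * Mf * 8) * (t - x) ^ 2 := by
        positivity
      linarith
    have h2M : |h t - h x| * (1 + x ^ 2) ≤ 2 * Mf * (1 + x ^ 2) := by
      refine mul_le_mul_of_nonneg_right ?_ (hφ x).le
      have := abs_sub (h t) (h x)
      linarith [hb t ht, hb x hx]
    have p1 : 0 ≤ ε / 2 * (1 + x ^ 2) := by positivity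
    have p2 : 0 ≤ 2 * Mf * ((1 + 4 * X ^ 2) / d ^ 2) * (t - x) ^ 2 := by positivity
    have p3 : 0 ≤ 2 * Mf * 8 * (t - x) ^ 2 := by positivity
    rcases le_or_gt x (2 * X) with hxX | hxX
    · rcases lt_or_ge |t - x| d with htx | htx
      · apply hsmall
        have ht2 := (abs_lt.1 htx).2
        have := hδ' t ⟨ht, by linarith⟩ x ⟨hx, by linarith⟩ (by rw [Real.dist_eq]; linarith)
        rw [Real.dist_eq] at this
        exact this.le
      · have hsq : d ^ 2 ≤ (t - x) ^ 2 := by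
          rw [← sq_abs (t - x)]; gcongr
        have : 1 + x ^ 2 ≤ (1 + 4 * X ^ 2) / d ^ 2 * (t - x) ^ 2 := by
          rw [div_mul_eq_mul_div, le_div_iff₀ (by positivity)]
          have : 1 + x ^ 2 ≤ 1 + 4 * X ^ 2 := by nlinarith
          gcongr
        have := mul_le_mul_of_nonneg_left this (by positivity : 0 ≤ 2 * Mf)
        linarith
    · rcases le_or_gt X t with htX | htX
      · apply hsmall
        have h1 := hX0 t (le_trans (le_max_left _ _) htX)
        have h2 := hX0 x (le_trans (le_max_left _ _) (by linarith : X ≤ x))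
        rw [Real.dist_eq] at h1 h2
        have := abs_sub_le (h t) L (h x)
        rw [abs_sub_comm L] at this
        linarith
      · have : 1 + x ^ 2 ≤ 8 * (t - x) ^ 2 := by
          have h1 : x / 2 ≤ x - t := by linarith
          have h2 : (x / 2) ^ 2 ≤ (x - t) ^ 2 := by gcongr
          nlinarith
        have := mul_le_mul_of_nonneg_left this (by positivity : 0 ≤ 2 * Mf)
        linarith
  obtain ⟨D, hD, hkey⟩ := key
  refine ⟨D + Mf * (1 + 2 * Mf / ε), by positivity, ?_⟩
  intro x t hx ht
  have e1 : f t - f x = h t * ((t - x) * (t + x)) + (h t - h x) * (1 + x ^ 2) := by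
    rw [hfh t, hfh x]; ring
  have e2 : |h t * ((t - x) * (t + x))| ≤ Mf * ((t - x) ^ 2 + 2 * x * |t - x|) := by
    rw [abs_mul]
    refine mul_le_mul (hb t ht) ?_ (abs_nonneg _) hMf.le
    rw [show (t - x) * (t + x) = (t - x) ^ 2 + 2 * x * (t - x) by ring]
    refine (abs_add_le _ _).trans ?_
    rw [abs_of_nonneg (sq_nonneg _), abs_mul, abs_of_nonneg (by positivity : 0 ≤ 2 * x)]
  have e3 : Mf * (2 * x * |t - x|) ≤ ε / 2 * x ^ 2 + Mf * (2 * Mf / ε) * (t - x) ^ 2 := by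
    rw [← sq_abs (t - x)]
    have : 0 ≤ (ε * x - 2 * Mf * |t - x|) ^ 2 / (2 * ε) := by positivity
    have e : (ε * x - 2 * Mf * |t - x|) ^ 2 / (2 * ε) =
      ε / 2 * x ^ 2 + Mf * (2 * Mf / ε) * |t - x| ^ 2 - Mf * (2 * x * |t - x|) := by
      field_simp; ring
    linarith
  have e4 := hkey x t hx ht
  rw [e1]
  refine (abs_add_le _ _).trans ?_
  rw [abs_mul (h t - h x), abs_of_pos (hφ x)]
  linarith

/-- Korovkin-type weighted convergence with weight `φ(x) = 1 + x²`:
`lim_{n→∞} sup_{x≥0} |M_n^{(α,β)}f(x) − f(x)|/(1+x²) = 0`. -/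
theorem stmt_13 (α β : ℝ) (hα : -1 < α) (hβ : 0 ≤ β) (f : ℝ → ℝ)
    (hf : ContinuousOn f (Set.Ici 0))
    (Mf : ℝ) (hMf : 0 < Mf) (hbound : ∀ x : ℝ, 0 ≤ x → |f x| ≤ Mf * (1 + x ^ 2))
    (hlim : ∃ L : ℝ, Filter.Tendsto (fun x => f x / (1 + x ^ 2)) Filter.atTop (nhds L)) :
    ∀ ε > (0 : ℝ), ∃ N : ℕ, ∀ n : ℕ, N ≤ n → β < n →
      ∀ x : ℝ, 0 ≤ x → |M α β n f x - f x| / (1 + x ^ 2) ≤ ε := by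
  intro ε hε
  obtain ⟨L, hL⟩ := hlim
  obtain ⟨C, hC, hpt⟩ := ptwise f hf Mf hMf hbound L hL (ε / 2) (by positivity)
  set D := β ^ 2 + 2 * (α + 1 + 1) * (1 + β) + (α + 1) * (α + 1 + 1) with hD
  obtain ⟨N, hN⟩ := exists_nat_ge (β + 1 + C * D / (ε / 2))
  refine ⟨N, fun n hNn hn x hx => ?_⟩
  have hA : 0 < α + 1 := by linarith
  have hD0 : 0 ≤ D := by positivity
  have hNn' : (N:ℝ) ≤ n := by exact_mod_cast hNn
  have hq : 0 ≤ C * D / (ε / 2) := by positivity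
  have ha : 1 ≤ (n:ℝ) - β := by linarith
  have hest := M_est α β hα n hn f hf x (f x) (ε / 2 * (1 + x ^ 2)) C hx
    (fun t ht => hpt x t hx ht)
  have hm := second_moment (α + 1) β ((n:ℝ) - β) x hA hβ ha hx
  rw [sub_add_cancel] at hm
  rw [div_le_iff₀ (by positivity)]
  have hm' := mul_le_mul_of_nonneg_left hm hC
  have hfin : C * (D / ((n:ℝ) - β) * (1 + x ^ 2)) ≤ ε / 2 * (1 + x ^ 2) := by
    rw [← mul_assoc]
    refine mul_le_mul_of_nonneg_right ?_ (by positivity)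
    rw [← mul_div_assoc, div_le_iff₀ (by linarith)]
    have : C * D / (ε / 2) ≤ n - β := by linarith
    rw [div_le_iff₀ (by positivity)] at this
    linarith
  have e1 : α + 1 + 1 = α + 2 := by ring
  have e2 : (n:ℝ) * x + (α + 1) = n * x + α + 1 := by ring
  rw [← hD] at hm'
  rw [e1, e2] at hm'
  linarith
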